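/- Let x^1, …, x^T be price relative vectors with x^t ∈ [a,1]^N for some 0 < a ≤ 1 and max_i x^t_i = 1 for each t. Let w^1 = (1/N,…,1/N), set η = a√(2 log N) / (a√(2 log N) + √T), and define w^{t+1}_i = w^t_i (1 + η (x^t_i/(w^t·x^t) − 1)). Then for every u ∈ Δ^N, ∑_{t=1}^T log(u·x^t) − ∑_{t=1}^T log(w^t·x^t) ≤ √(2 T log N)/a + log N. -/

import Mathlib

theorem Real.log_le_sub_inv_div_two {q : ℝ} (hq : 1 ≤ q) : Real.log q ≤ (q - q⁻¹) / 2 := by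
  rw [← Real.sinh_log (by linarith)]
  exact Real.self_le_sinh_iff.2 (Real.log_nonneg hq)

theorem Real.sub_sq_div_le_log_one_add {η y : ℝ} (hη0 : 0 ≤ η) (hη1 : η < 1) (hy : -η ≤ y) :
    y - y ^ 2 / (2 * (1 - η)) ≤ Real.log (1 + y) := by
  rcases le_total 0 y with h | h
  · refine le_trans ?_ (Real.le_log_one_add_of_nonneg h)
    have h1 : y ^ 2 / 2 ≤ y ^ 2 / (2 * (1 - η)) :=
      div_le_div_of_nonneg_left (sq_nonneg y) (by linarith) (by linarith)
    refine le_trans (sub_le_sub_left h1 y) ?_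
    rw [le_div_iff₀ (by linarith)]
    nlinarith [pow_nonneg h 3]
  · have hp : 0 < 1 + y := by linarith
    have h1 : y ^ 2 / (2 * (1 + y)) ≤ y ^ 2 / (2 * (1 - η)) :=
      div_le_div_of_nonneg_left (sq_nonneg y) (by linarith) (by linarith)
    have h2 := Real.log_le_sub_inv_div_two ((one_le_inv₀ hp).2 (by linarith))
    rw [Real.log_inv, inv_inv] at h2
    have h3 : y - y ^ 2 / (2 * (1 + y)) = -(((1 + y)⁻¹ - (1 + y)) / 2) := by
      field_simp
      ring
    linarith

section CauchySimplex

variable {ι : Type*} [Fintype ι] {a η : ℝ} {x w w' u : ι → ℝ}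

theorem sum_mul_mem_Icc_of_simplex {b : ℝ} (hx : ∀ i, x i ∈ Set.Icc a b) (hu : ∀ i, 0 ≤ u i)
    (hu1 : ∑ i, u i = 1) : ∑ i, u i * x i ∈ Set.Icc a b := by
  constructor
  · calc a = ∑ i, u i * a := by rw [← Finset.sum_mul, hu1, one_mul]
      _ ≤ _ := Finset.sum_le_sum fun i _ => mul_le_mul_of_nonneg_left (hx i).1 (hu i)
  · calc _ ≤ ∑ i, u i * b :=
        Finset.sum_le_sum fun i _ => mul_le_mul_of_nonneg_left (hx i).2 (hu i)
      _ = b := by rw [← Finset.sum_mul, hu1, one_mul]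

/-- A Cauchy-Simplex step with positive price relatives and `η ∈ [0, 1)` preserves the
interior of the simplex. -/
theorem cauchySimplex_step_mem (hη0 : 0 ≤ η) (hη1 : η < 1) (hx : ∀ i, 0 ≤ x i)
    (hw : ∀ i, 0 < w i) (hw1 : ∑ i, w i = 1) (hwx : 0 < ∑ j, w j * x j)
    (hw' : ∀ i, w' i = w i * (1 + η * (x i / (∑ j, w j * x j) - 1))) :
    (∀ i, 0 < w' i) ∧ ∑ i, w' i = 1 := by
  constructor
  · intro i
    rw [hw' i]
    have : 0 ≤ η * (x i / ∑ j, w j * x j) := mul_nonneg hη0 (div_nonneg (hx i) hwx.le)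
    exact mul_pos (hw i) (by linarith)
  · have h : ∀ i, w' i = (1 - η) * w i + η / (∑ j, w j * x j) * (w i * x i) := by
      intro i
      rw [hw' i]
      ring
    simp only [h]
    rw [Finset.sum_add_distrib, ← Finset.mul_sum, ← Finset.mul_sum, hw1,
      div_mul_cancel₀ _ hwx.ne']
    ring

/-- The one-step log-regret is controlled by the change of the potential `∑ i, u i * log (w i)`. -/
theorem cauchySimplex_step_log_regret_le (ha0 : 0 < a) (ha1 : a ≤ 1) (hη0 : 0 < η) (hη1 : η < 1)
    (hx : ∀ i, x i ∈ Set.Icc a 1) (hw : ∀ i, 0 < w i) (hw1 : ∑ i, w i = 1)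
    (hw' : ∀ i, w' i = w i * (1 + η * (x i / (∑ j, w j * x j) - 1)))
    (hu : ∀ i, 0 ≤ u i) (hu1 : ∑ i, u i = 1) :
    Real.log (∑ i, u i * x i) - Real.log (∑ i, w i * x i) ≤
      (∑ i, u i * Real.log (w' i) - ∑ i, u i * Real.log (w i)) / η
        + η / (2 * (1 - η) * a ^ 2) := by
  set W := ∑ i, w i * x i with hW
  have hWa : a ≤ W := (sum_mul_mem_Icc_of_simplex hx (fun i => (hw i).le) hw1).1
  have hUa : a ≤ ∑ i, u i * x i := (sum_mul_mem_Icc_of_simplex hx hu hu1).1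
  have hW0 : 0 < W := by linarith
  have hη1' : 0 < 1 - η := by linarith
  set z : ι → ℝ := fun i => x i / W - 1 with hz
  have hratio : ∀ i, 0 ≤ x i / W ∧ x i / W ≤ 1 / a := fun i =>
    ⟨div_nonneg (ha0.le.trans (hx i).1) hW0.le, div_le_div₀ zero_le_one (hx i).2 ha0 hWa⟩
  have h1a : 1 ≤ 1 / a := (one_le_div ha0).2 ha1
  have hzsq : ∀ i, z i ^ 2 ≤ 1 / a ^ 2 := by
    intro i
    rw [← one_div_pow]
    have := hratio i
    exact sq_le_sq' (by simp only [hz]; linarith) (by simp only [hz]; linarith)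
  have hlog : ∀ i, η * z i - η ^ 2 / (2 * (1 - η) * a ^ 2) ≤
      Real.log (w' i) - Real.log (w i) := by
    intro i
    have hy : -η ≤ η * z i := by
      have := mul_nonneg hη0.le (hratio i).1
      simp only [hz]
      linarith
    rw [hw' i, Real.log_mul (hw i).ne' (by simp only [hz] at hy; linarith), add_sub_cancel_left]
    refine le_trans ?_ (Real.sub_sq_div_le_log_one_add hη0.le hη1 hy)
    have : (η * z i) ^ 2 / (2 * (1 - η)) ≤ η ^ 2 / (2 * (1 - η) * a ^ 2) := by
      calc (η * z i) ^ 2 / (2 * (1 - η)) = η ^ 2 / (2 * (1 - η)) * z i ^ 2 := by ring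
        _ ≤ η ^ 2 / (2 * (1 - η)) * (1 / a ^ 2) :=
          mul_le_mul_of_nonneg_left (hzsq i) (by positivity)
        _ = _ := by rw [div_mul_div_comm, mul_one]
    linarith
  have hsum : η * (∑ i, u i * z i) - η ^ 2 / (2 * (1 - η) * a ^ 2) ≤
      ∑ i, u i * Real.log (w' i) - ∑ i, u i * Real.log (w i) := by
    calc _ = ∑ i, u i * (η * z i - η ^ 2 / (2 * (1 - η) * a ^ 2)) := by
          simp only [mul_sub]
          rw [Finset.sum_sub_distrib, ← Finset.sum_mul, hu1, one_mul, Finset.mul_sum]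
          simp only [mul_left_comm]
      _ ≤ ∑ i, u i * (Real.log (w' i) - Real.log (w i)) :=
          Finset.sum_le_sum fun i _ => mul_le_mul_of_nonneg_left (hlog i) (hu i)
      _ = _ := by simp only [mul_sub, Finset.sum_sub_distrib]
  have huz : ∑ i, u i * z i = (∑ i, u i * x i) / W - 1 := by
    simp only [hz, mul_sub, mul_one, Finset.sum_sub_distrib, hu1, Finset.sum_div, mul_div_assoc]
  have hle : Real.log (∑ i, u i * x i) - Real.log W ≤ ∑ i, u i * z i := by
    rw [huz, ← Real.log_div (by linarith) hW0.ne']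
    exact Real.log_le_sub_one_of_pos (div_pos (by linarith) hW0)
  refine hle.trans ?_
  rw [← sub_le_iff_le_add, le_div_iff₀ hη0]
  calc _ = η * (∑ i, u i * z i) - η ^ 2 / (2 * (1 - η) * a ^ 2) := by ring
    _ ≤ _ := hsum

end CauchySimplex

section CauchySimplexSequence

variable {ι : Type*} [Fintype ι] {a η : ℝ} {T : ℕ} {x w : ℕ → ι → ℝ} {u : ι → ℝ}

theorem cauchySimplex_iterate_mem (ha0 : 0 < a) (hη0 : 0 ≤ η) (hη1 : η < 1)
    (hx : ∀ t ∈ Finset.Icc 1 T, ∀ i, x t i ∈ Set.Icc a 1)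
    (hw0 : ∀ i, 0 < w 1 i) (hw1 : ∑ i, w 1 i = 1)
    (hupdate : ∀ t ∈ Finset.Icc 1 T, ∀ i,
      w (t + 1) i = w t i * (1 + η * (x t i / (∑ j, w t j * x t j) - 1)))
    {n : ℕ} (hn : n ≤ T) : (∀ i, 0 < w (n + 1) i) ∧ ∑ i, w (n + 1) i = 1 := by
  induction n with
  | zero => exact ⟨hw0, hw1⟩
  | succ k ih =>
    obtain ⟨h0, h1⟩ := ih (by lia)
    have hk : k + 1 ∈ Finset.Icc 1 T := Finset.mem_Icc.2 ⟨by lia, hn⟩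
    exact cauchySimplex_step_mem hη0 hη1 (fun i => ha0.le.trans (hx _ hk i).1) h0 h1
      (ha0.trans_le (sum_mul_mem_Icc_of_simplex (hx _ hk) (fun i => (h0 i).le) h1).1)
      (hupdate _ hk)

theorem cauchySimplex_log_regret_le (ha0 : 0 < a) (ha1 : a ≤ 1) (hη0 : 0 < η) (hη1 : η < 1)
    (hx : ∀ t ∈ Finset.Icc 1 T, ∀ i, x t i ∈ Set.Icc a 1)
    (hw0 : ∀ i, 0 < w 1 i) (hw1 : ∑ i, w 1 i = 1)
    (hupdate : ∀ t ∈ Finset.Icc 1 T, ∀ i,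
      w (t + 1) i = w t i * (1 + η * (x t i / (∑ j, w t j * x t j) - 1)))
    (hu : ∀ i, 0 ≤ u i) (hu1 : ∑ i, u i = 1) :
    (∑ t ∈ Finset.Icc 1 T, Real.log (∑ i, u i * x t i))
        - ∑ t ∈ Finset.Icc 1 T, Real.log (∑ i, w t i * x t i) ≤
      -(∑ i, u i * Real.log (w 1 i)) / η + T * (η / (2 * (1 - η) * a ^ 2)) := by
  have hmem := fun n hn =>
    cauchySimplex_iterate_mem (n := n) ha0 hη0.le hη1 hx hw0 hw1 hupdate hn
  have htele : ∀ n ≤ T, (∑ t ∈ Finset.Icc 1 n, Real.log (∑ i, u i * x t i))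
        - ∑ t ∈ Finset.Icc 1 n, Real.log (∑ i, w t i * x t i) ≤
      (∑ i, u i * Real.log (w (n + 1) i) - ∑ i, u i * Real.log (w 1 i)) / η
        + n * (η / (2 * (1 - η) * a ^ 2)) := by
    intro n
    induction n with
    | zero => simp
    | succ k ih =>
      intro hk
      obtain ⟨h0, h1⟩ := hmem k (by lia)
      have hk' : k + 1 ∈ Finset.Icc 1 T := Finset.mem_Icc.2 ⟨by lia, hk⟩
      have hstep := cauchySimplex_step_log_regret_le ha0 ha1 hη0 hη1 (hx _ hk') h0 h1
        (hupdate _ hk') hu hu1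
      have := ih (by lia)
      rw [Finset.sum_Icc_succ_top (by lia), Finset.sum_Icc_succ_top (by lia)]
      push_cast
      simp only [sub_div] at this hstep ⊢
      linarith
  obtain ⟨hT0, hT1⟩ := hmem T le_rfl
  have hfinal : ∑ i, u i * Real.log (w (T + 1) i) ≤ 0 := by
    refine Finset.sum_nonpos fun i _ => mul_nonpos_of_nonneg_of_nonpos (hu i) ?_
    refine Real.log_nonpos (hT0 i).le (hT1 ▸ ?_)
    exact Finset.single_le_sum (fun j _ => (hT0 j).le) (Finset.mem_univ i)
  refine (htele T le_rfl).trans (add_le_add_left ?_ _)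
  exact div_le_div_of_nonneg_right (by linarith) hη0.le

end CauchySimplexSequence

/-- Tuned log-regret bound for the Cauchy-Simplex universal portfolio: with uniform
initialization and `η = a√(2 log N)/(a√(2 log N) + √T)`, the log-regret against any
fixed-weight portfolio `u ∈ Δ^N` is at most `√(2 T log N)/a + log N`. -/
theorem cauchy_simplex_portfolio_log_regret_tuned {N : ℕ} (hN : 0 < N) (T : ℕ)
    (a : ℝ) (ha0 : 0 < a) (ha1 : a ≤ 1)
    (x : ℕ → Fin N → ℝ)
    (hx : ∀ t ∈ Finset.Icc 1 T, ∀ i, x t i ∈ Set.Icc a 1)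
    (hxmax : ∀ t ∈ Finset.Icc 1 T, ∃ i, x t i = 1)
    (η : ℝ)
    (hη : η = a * Real.sqrt (2 * Real.log N)
      / (a * Real.sqrt (2 * Real.log N) + Real.sqrt T))
    (w : ℕ → Fin N → ℝ) (hw1 : ∀ i, w 1 i = 1 / N)
    (hupdate : ∀ t ∈ Finset.Icc 1 T, ∀ i,
      w (t + 1) i = w t i * (1 + η * (x t i / (∑ j, w t j * x t j) - 1)))
    (u : Fin N → ℝ) (hupos : ∀ i, 0 ≤ u i) (husum : ∑ i, u i = 1) :
    (∑ t ∈ Finset.Icc 1 T, Real.log (∑ i, u i * x t i))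
        - ∑ t ∈ Finset.Icc 1 T, Real.log (∑ i, w t i * x t i)
      ≤ Real.sqrt (2 * T * Real.log N) / a + Real.log N := by
  rcases Nat.eq_zero_or_pos T with rfl | hT
  · simpa using Real.log_natCast_nonneg N
  rcases Nat.lt_or_ge 1 N with hN1 | hN1
  · have hL : 0 < Real.log N := Real.log_pos (by exact_mod_cast hN1)
    have hTpos : (0 : ℝ) < T := by exact_mod_cast hT
    have hNpos : (0 : ℝ) < N := by exact_mod_cast hN
    set s := Real.sqrt (2 * Real.log N) with hs
    set r := Real.sqrt T with hr
    have hs0 : 0 < s := Real.sqrt_pos.2 (by linarith)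
    have hr0 : 0 < r := Real.sqrt_pos.2 hTpos
    have hs2 : s ^ 2 = 2 * Real.log N := Real.sq_sqrt (by linarith)
    have hr2 : r ^ 2 = T := Real.sq_sqrt hTpos.le
    have hη0 : 0 < η := by rw [hη]; positivity
    have hη1 : η < 1 := by
      rw [hη, div_lt_one (by positivity)]
      linarith
    have hbound := cauchySimplex_log_regret_le ha0 ha1 hη0 hη1 hx
      (fun i => by rw [hw1 i]; positivity)
      (by simp [hw1, hNpos.ne']) hupdate hupos husum
    have hinit : -(∑ i, u i * Real.log (w 1 i)) = Real.log N := by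
      simp [hw1, ← Finset.sum_mul, husum]
    rw [hinit] at hbound
    refine hbound.trans (le_of_eq ?_)
    have hsqrt : Real.sqrt (2 * T * Real.log N) = s * r := by
      rw [hs, hr, ← Real.sqrt_mul (by linarith)]
      congr 1
      ring
    have h1η : 1 - η = r / (a * s + r) := by
      rw [hη]
      field_simp
      ring
    have hlog : Real.log N = s ^ 2 / 2 := by linarith
    rw [hsqrt, h1η, hη, hlog, ← hr2]
    field_simp
    ring
  · obtain rfl : N = 1 := by lia
    have hη0 : η = 0 := by simp [hη]
    have hw : ∀ n ≤ T, w (n + 1) 0 = 1 := by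
      intro n hn
      induction n with
      | zero => simp [hw1]
      | succ k ih =>
        rw [hupdate (k + 1) (Finset.mem_Icc.2 ⟨by lia, hn⟩), ih (by lia), hη0]
        simp
    have hu : u 0 = 1 := by simpa using husum
    have hEq : ∑ t ∈ Finset.Icc 1 T, Real.log (∑ i, u i * x t i)
        = ∑ t ∈ Finset.Icc 1 T, Real.log (∑ i, w t i * x t i) := by
      refine Finset.sum_congr rfl fun t ht => ?_
      obtain ⟨h1, h2⟩ := Finset.mem_Icc.1 ht
      obtain ⟨k, rfl⟩ : ∃ k, t = k + 1 := ⟨t - 1, by lia⟩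
      simp [hu, hw k (by lia)]
    rw [hEq]
    simp
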